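/- Let Σ be a binding signature and M, M' : NomTrm nameful terms. If M and M' are α-equivalent (M ∼ M'), then their translations into well-scoped locally nameless terms are equal: ⟦M⟧ = ⟦M'⟧ (soundness of the translation for α-equivalence). -/

import Mathlib

/- A Plotkin-style binding signature: operators with arities. -/
structure Sig where
  Op : Type
  ar : Op → List ℕ

/- Well-scoped locally nameless terms and argument lists over a signature.
Atoms are natural numbers. -/
mutual
inductive Trm (S : Sig) : ℕ → Type where
  | idx : {n : ℕ} → Fin n → Trm S n
  | atm : {n : ℕ} → ℕ → Trm S n
  | op  : {n : ℕ} → (o : S.Op) → Args S n (S.ar o) → Trm S n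
inductive Args (S : Sig) : ℕ → List ℕ → Type where
  | nil : {n : ℕ} → Args S n []
  | cons : {n m : ℕ} → {ms : List ℕ} → Trm S (m + n) → Args S n ms → Args S n (m :: ms)
end

variable {S : Sig}

/- Scope weakening. -/
mutual
def Trm.weaken : {m n : ℕ} → m ≤ n → Trm S m → Trm S n
  | _, _, h, .idx i => .idx (Fin.castLE h i)
  | _, _, _, .atm x => .atm x
  | _, _, h, .op o as => .op o (Args.weaken h as)
def Args.weaken : {m n : ℕ} → {ms : List ℕ} → m ≤ n → Args S m ms → Args S n ms
  | _, _, _, _, .nil => .nil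
  | _, _, _, h, .cons t ts => .cons (Trm.weaken (Nat.add_le_add_left h _) t) (Args.weaken h ts)
end

/- Support: the finite set of atoms occurring in a term. -/
mutual
def Trm.supp : {n : ℕ} → Trm S n → Finset ℕ
  | _, .idx _ => ∅
  | _, .atm x => {x}
  | _, .op _ as => Args.supp as
def Args.supp : {n : ℕ} → {ms : List ℕ} → Args S n ms → Finset ℕ
  | _, _, .nil => ∅
  | _, _, .cons t ts => Trm.supp t ∪ Args.supp ts
end

/- Action of a substitution σ : 𝔸 → Trm on terms. -/
mutual
def Trm.subst (σ : ℕ → Trm S 0) : {n : ℕ} → Trm S n → Trm S n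
  | _, .idx i => .idx i
  | n, .atm x => Trm.weaken (Nat.zero_le n) (σ x)
  | _, .op o as => .op o (Args.subst σ as)
def Args.subst (σ : ℕ → Trm S 0) : {n : ℕ} → {ms : List ℕ} → Args S n ms → Args S n ms
  | _, _, .nil => .nil
  | _, _, .cons t ts => .cons (Trm.subst σ t) (Args.subst σ ts)
end

/- The single substitution (x := u). -/
def single (x : ℕ) (u : Trm S 0) : ℕ → Trm S 0 := fun y => if x = y then u else .atm y

/- Renaming a term along ρ : 𝔸 → 𝔸, i.e. substitution along 𝐚 ∘ ρ. -/
def Trm.rename (ρ : ℕ → ℕ) {n : ℕ} (t : Trm S n) : Trm S n :=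
  Trm.subst (fun z => .atm (ρ z)) t

/- Opening (i ↝ u)t : replace index i by the 0-term u. -/
mutual
def Trm.opn : {n : ℕ} → Fin (n+1) → Trm S 0 → Trm S (n+1) → Trm S n
  | n, i, u, .idx j =>
      match finSuccEquiv' i j with
      | none => Trm.weaken (Nat.zero_le n) u
      | some k => .idx k
  | _, _, _, .atm x => .atm x
  | _, i, u, .op o as => .op o (Args.opn i u as)
def Args.opn : {n : ℕ} → {ms : List ℕ} → Fin (n+1) → Trm S 0 → Args S (n+1) ms → Args S n ms
  | _, _, _, _, .nil => .nil
  | _, _, i, u, .cons (m := k) t ts => .cons (Trm.opn (Fin.natAdd k i) u t) (Args.opn i u ts)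
end

/- Concretion t[u] of a (1+n)-term at a 0-term. -/
def Trm.conc {n : ℕ} (t : Trm S (n+1)) (u : Trm S 0) : Trm S n := Trm.opn 0 u t

/- Closing (i ↜ x)t : replace the atom x by the index i. -/
mutual
def Trm.cls : {n : ℕ} → Fin (n+1) → ℕ → Trm S n → Trm S (n+1)
  | _, i, _, .idx j => .idx (i.succAbove j)
  | _, i, x, .atm y => if x = y then .idx i else .atm y
  | _, i, x, .op o as => .op o (Args.cls i x as)
def Args.cls : {n : ℕ} → {ms : List ℕ} → Fin (n+1) → ℕ → Args S n ms → Args S (n+1) ms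
  | _, _, _, _, .nil => .nil
  | _, _, i, x, .cons (m := k) t ts => .cons (Trm.cls (Fin.natAdd k i) x t) (Args.cls i x ts)
end

/- Abstraction ⟨x⟩t. -/
def Trm.abs (x : ℕ) {n : ℕ} (t : Trm S n) : Trm S (n+1) := Trm.cls 0 x t

/- Size of a term. -/
mutual
def Trm.size : {n : ℕ} → Trm S n → ℕ
  | _, .idx _ => 0
  | _, .atm _ => 0
  | _, .op _ as => 1 + Args.size as
def Args.size : {n : ℕ} → {ms : List ℕ} → Args S n ms → ℕ
  | _, _, .nil => 0
  | _, _, .cons t ts => max (Trm.size t) (Args.size ts)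
end

/- Nameful terms, argument lists and n-ary bindings over a signature. -/
mutual
inductive NomTrm (S : Sig) : Type where
  | atm : ℕ → NomTrm S
  | op : (o : S.Op) → NomArg S (S.ar o) → NomTrm S
inductive NomArg (S : Sig) : List ℕ → Type where
  | nil : NomArg S []
  | cons : {m : ℕ} → {ms : List ℕ} → NomBind S m → NomArg S ms → NomArg S (m :: ms)
inductive NomBind (S : Sig) : ℕ → Type where
  | body : NomTrm S → NomBind S 0
  | bind : {m : ℕ} → ℕ → NomBind S m → NomBind S (m+1)
end

/- Support of a nameful term: all atoms occurring, in atom or binding position. -/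
mutual
def NomTrm.nsupp : NomTrm S → Finset ℕ
  | .atm x => {x}
  | .op _ bs => NomArg.nsupp bs
def NomArg.nsupp : {ms : List ℕ} → NomArg S ms → Finset ℕ
  | _, .nil => ∅
  | _, .cons b bs => NomBind.nsupp b ∪ NomArg.nsupp bs
def NomBind.nsupp : {m : ℕ} → NomBind S m → Finset ℕ
  | _, .body M => NomTrm.nsupp M
  | _, .bind x b => insert x (NomBind.nsupp b)
end

/- Renaming of nameful terms: apply ρ to every atom occurrence, including
binding positions. -/
mutual
def NomTrm.rename (ρ : ℕ → ℕ) : NomTrm S → NomTrm S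
  | .atm x => .atm (ρ x)
  | .op o bs => .op o (NomArg.rename ρ bs)
def NomArg.rename (ρ : ℕ → ℕ) : {ms : List ℕ} → NomArg S ms → NomArg S ms
  | _, .nil => .nil
  | _, .cons b bs => .cons (NomBind.rename ρ b) (NomArg.rename ρ bs)
def NomBind.rename (ρ : ℕ → ℕ) : {m : ℕ} → NomBind S m → NomBind S m
  | _, .body M => .body (NomTrm.rename ρ M)
  | _, .bind x b => .bind (ρ x) (NomBind.rename ρ b)
end

/- The single renaming function sending x to y and fixing all other atoms. -/
def rn1 (x y : ℕ) : ℕ → ℕ := fun z => if x = z then y else z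

/- α-equivalence of nameful terms. -/
mutual
inductive AEq {S : Sig} : NomTrm S → NomTrm S → Prop where
  | atm (x : ℕ) : AEq (.atm x) (.atm x)
  | op {o : S.Op} {bs bs' : NomArg S (S.ar o)} :
      AEqArg bs bs' → AEq (.op o bs) (.op o bs')
inductive AEqArg {S : Sig} : {ms : List ℕ} → NomArg S ms → NomArg S ms → Prop where
  | nil : AEqArg .nil .nil
  | cons {m : ℕ} {ms : List ℕ} {b b' : NomBind S m} {bs bs' : NomArg S ms} :
      AEqBind b b' → AEqArg bs bs' → AEqArg (.cons b bs) (.cons b' bs')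
inductive AEqBind {S : Sig} : {m : ℕ} → NomBind S m → NomBind S m → Prop where
  | body {M M' : NomTrm S} : AEq M M' → AEqBind (.body M) (.body M')
  | bind {m : ℕ} {x x' y : ℕ} {b b' : NomBind S m} :
      y ∉ NomBind.nsupp b → y ∉ NomBind.nsupp b' →
      AEqBind (NomBind.rename (rn1 x y) b) (NomBind.rename (rn1 x' y) b') →
      AEqBind (.bind x b) (.bind x' b')
end

/- Translation of nameful terms into well-scoped locally nameless terms;
bindings translate to iterated abstractions. -/
mutual
def NomTrm.transl : NomTrm S → Trm S 0
  | .atm x => .atm x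
  | .op o bs => .op o (NomArg.transl bs)
def NomArg.transl : {ms : List ℕ} → NomArg S ms → Args S 0 ms
  | _, .nil => .nil
  | _, .cons b bs => .cons (NomBind.transl b) (NomArg.transl bs)
def NomBind.transl : {m : ℕ} → NomBind S m → Trm S m
  | _, .body M => NomTrm.transl M
  | _, .bind x b => Trm.cls 0 x (NomBind.transl b)
end

/- A chosen atom not in a given finite set (one more than its maximum). -/
def newAtom (s : Finset ℕ) : ℕ := s.sup id + 1

/- Capture-avoiding substitution of nameful terms for atoms. -/
mutual
def NomTrm.nsubst (σ : ℕ → NomTrm S) : NomTrm S → NomTrm S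
  | .atm x => σ x
  | .op o bs => .op o (NomArg.nsubst σ bs)
def NomArg.nsubst (σ : ℕ → NomTrm S) : {ms : List ℕ} → NomArg S ms → NomArg S ms
  | _, .nil => .nil
  | _, .cons b bs => .cons (NomBind.nsubst σ b) (NomArg.nsubst σ bs)
def NomBind.nsubst (σ : ℕ → NomTrm S) : {m : ℕ} → NomBind S m → NomBind S m
  | _, .body M => .body (NomTrm.nsubst σ M)
  | _, .bind x b =>
      let y := newAtom ((NomBind.nsupp b).biUnion (fun z => NomTrm.nsupp (σ z)))
      .bind y (NomBind.nsubst (fun z => if x = z then .atm y else σ z) b)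
end

theorem rn1_injOn {x y : ℕ} {s : Finset ℕ} (hy : y ∉ s) : Set.InjOn (rn1 x y) s := by
  intro z hz w hw h
  simp only [Finset.mem_coe] at hz hw
  unfold rn1 at h
  split_ifs at h <;> grind

/- Closing creates no new atoms. -/
mutual
theorem Trm.supp_cls_subset : {n : ℕ} → (i : Fin (n+1)) → (x : ℕ) → (t : Trm S n) →
    (Trm.cls i x t).supp ⊆ t.supp
  | _, _, _, .idx _ => by simp [Trm.cls, Trm.supp]
  | _, _, x, .atm y => by
      simp only [Trm.cls]
      split_ifs <;> simp [Trm.supp]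
  | _, i, x, .op _ as => by simpa only [Trm.cls, Trm.supp] using Args.supp_cls_subset i x as
theorem Args.supp_cls_subset : {n : ℕ} → {ms : List ℕ} → (i : Fin (n+1)) → (x : ℕ) →
    (as : Args S n ms) → (Args.cls i x as).supp ⊆ as.supp
  | _, _, _, _, .nil => by simp [Args.cls, Args.supp]
  | _, _, i, x, .cons t ts => by
      simpa only [Args.cls, Args.supp] using
        Finset.union_subset_union (Trm.supp_cls_subset _ x t) (Args.supp_cls_subset i x ts)
end

mutual
theorem NomTrm.supp_transl_subset : (M : NomTrm S) → M.transl.supp ⊆ M.nsupp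
  | .atm _ => by simp [NomTrm.transl, Trm.supp, NomTrm.nsupp]
  | .op _ bs => by
      simpa only [NomTrm.transl, Trm.supp, NomTrm.nsupp] using NomArg.supp_transl_subset bs
theorem NomArg.supp_transl_subset : {ms : List ℕ} → (bs : NomArg S ms) →
    bs.transl.supp ⊆ bs.nsupp
  | _, .nil => by simp [NomArg.transl, Args.supp]
  | _, .cons b bs => by
      simpa only [NomArg.transl, Args.supp, NomArg.nsupp] using
        Finset.union_subset_union (NomBind.supp_transl_subset b) (NomArg.supp_transl_subset bs)
theorem NomBind.supp_transl_subset : {m : ℕ} → (b : NomBind S m) → b.transl.supp ⊆ b.nsupp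
  | _, .body M => by
      simpa only [NomBind.transl, NomBind.nsupp] using NomTrm.supp_transl_subset M
  | _, .bind x b => by
      simp only [NomBind.transl, NomBind.nsupp]
      exact ((Trm.supp_cls_subset 0 x _).trans (NomBind.supp_transl_subset b)).trans
        (Finset.subset_insert _ _)
end

/- Renaming commutes with closing at an atom that the renaming does not identify with another. -/
mutual
theorem Trm.subst_cls (ρ : ℕ → ℕ) (x : ℕ) : {n : ℕ} → (i : Fin (n+1)) → (t : Trm S n) →
    (∀ z ∈ t.supp, ρ x = ρ z → x = z) →
    Trm.subst (fun z => .atm (ρ z)) (Trm.cls i x t) =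
      Trm.cls i (ρ x) (Trm.subst (fun z => .atm (ρ z)) t)
  | _, _, .idx _, _ => by simp [Trm.cls, Trm.subst]
  | _, _, .atm y, h => by
      have h : ρ x = ρ y → x = y := h y (by simp [Trm.supp])
      by_cases hxy : x = y
      · simp [Trm.cls, Trm.subst, Trm.weaken, hxy]
      · simp [Trm.cls, Trm.subst, Trm.weaken, hxy, mt h hxy]
  | _, i, .op _ as, h => by
      simp only [Trm.cls, Trm.subst, Args.subst_cls ρ x i as (by simpa only [Trm.supp] using h)]
theorem Args.subst_cls (ρ : ℕ → ℕ) (x : ℕ) : {n : ℕ} → {ms : List ℕ} → (i : Fin (n+1)) →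
    (as : Args S n ms) → (∀ z ∈ as.supp, ρ x = ρ z → x = z) →
    Args.subst (fun z => .atm (ρ z)) (Args.cls i x as) =
      Args.cls i (ρ x) (Args.subst (fun z => .atm (ρ z)) as)
  | _, _, _, .nil, _ => by simp [Args.cls, Args.subst]
  | _, _, i, .cons t ts, h => by
      simp only [Args.supp, Finset.mem_union] at h
      simp only [Args.cls, Args.subst]
      rw [← Args.subst_cls ρ x i ts fun z hz => h z (.inr hz)]
      congr 1
      exact Trm.subst_cls ρ x _ t fun z hz => h z (.inl hz)
end

/- Closing at a fresh atom `y` after renaming `x` to `y` is closing at `x`. -/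
mutual
theorem Trm.cls_subst_rn1 (x y : ℕ) : {n : ℕ} → (i : Fin (n+1)) → (t : Trm S n) → y ∉ t.supp →
    Trm.cls i y (Trm.subst (fun z => .atm (rn1 x y z)) t) = Trm.cls i x t
  | _, _, .idx _, _ => by simp [Trm.cls, Trm.subst]
  | _, _, .atm z, h => by
      have h : y ≠ z := by simpa [Trm.supp] using h
      by_cases hxz : x = z <;> simp [Trm.cls, Trm.subst, Trm.weaken, rn1, hxz, h]
  | _, i, .op _ as, h => by
      simp only [Trm.cls, Trm.subst, Args.cls_subst_rn1 x y i as (by simpa only [Trm.supp] using h)]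
theorem Args.cls_subst_rn1 (x y : ℕ) : {n : ℕ} → {ms : List ℕ} → (i : Fin (n+1)) →
    (as : Args S n ms) → y ∉ as.supp →
    Args.cls i y (Args.subst (fun z => .atm (rn1 x y z)) as) = Args.cls i x as
  | _, _, _, .nil, _ => by simp [Args.cls, Args.subst]
  | _, _, i, .cons t ts, h => by
      simp only [Args.supp, Finset.mem_union, not_or] at h
      simp only [Args.cls, Args.subst]
      rw [Args.cls_subst_rn1 x y i ts h.2]
      congr 1
      exact Trm.cls_subst_rn1 x y _ t h.1
end

/- Translation commutes with renamings that are injective on the support. -/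
mutual
theorem NomTrm.transl_rename (ρ : ℕ → ℕ) : (M : NomTrm S) → Set.InjOn ρ M.nsupp →
    (M.rename ρ).transl = Trm.subst (fun z => .atm (ρ z)) M.transl
  | .atm _, _ => by simp [NomTrm.rename, NomTrm.transl, Trm.subst, Trm.weaken]
  | .op _ bs, h => by
      simp only [NomTrm.rename, NomTrm.transl, Trm.subst,
        NomArg.transl_rename ρ bs (by simpa only [NomTrm.nsupp] using h)]
theorem NomArg.transl_rename (ρ : ℕ → ℕ) : {ms : List ℕ} → (bs : NomArg S ms) →
    Set.InjOn ρ bs.nsupp →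
    (bs.rename ρ).transl = Args.subst (fun z => .atm (ρ z)) bs.transl
  | _, .nil, _ => by simp [NomArg.rename, NomArg.transl, Args.subst]
  | _, .cons b bs, h => by
      simp only [NomArg.nsupp, Finset.coe_union] at h
      simp only [NomArg.rename, NomArg.transl, Args.subst]
      rw [NomArg.transl_rename ρ bs (h.mono Set.subset_union_right)]
      congr 1
      exact NomBind.transl_rename ρ b (h.mono Set.subset_union_left)
theorem NomBind.transl_rename (ρ : ℕ → ℕ) : {m : ℕ} → (b : NomBind S m) →
    Set.InjOn ρ b.nsupp →
    (b.rename ρ).transl = Trm.subst (fun z => .atm (ρ z)) b.transl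
  | _, .body M, h => by
      simpa only [NomBind.rename, NomBind.transl] using
        NomTrm.transl_rename ρ M (by simpa only [NomBind.nsupp] using h)
  | _, .bind x b, h => by
      simp only [NomBind.nsupp, Finset.coe_insert] at h
      simp only [NomBind.rename, NomBind.transl]
      rw [NomBind.transl_rename ρ b (h.mono (Set.subset_insert _ _)), Trm.subst_cls]
      exact fun z hz => h (Set.mem_insert _ _)
        (Set.mem_insert_of_mem _ (NomBind.supp_transl_subset b hz))
end

theorem NomBind.cls_transl_rename {m : ℕ} (x : ℕ) {y : ℕ} (b : NomBind S m) (hy : y ∉ b.nsupp) :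
    Trm.cls 0 y (b.rename (rn1 x y)).transl = Trm.cls 0 x b.transl := by
  rw [NomBind.transl_rename _ b (rn1_injOn hy)]
  exact Trm.cls_subst_rn1 x y 0 _ fun h => hy (NomBind.supp_transl_subset b h)

mutual
theorem AEq.transl_eq : {M M' : NomTrm S} → AEq M M' → M.transl = M'.transl
  | _, _, .atm _ => rfl
  | _, _, .op h => by simp only [NomTrm.transl, AEqArg.transl_eq h]
theorem AEqArg.transl_eq : {ms : List ℕ} → {bs bs' : NomArg S ms} → AEqArg bs bs' →
    bs.transl = bs'.transl
  | _, _, _, .nil => rfl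
  | _, _, _, .cons h hs => by
      simp only [NomArg.transl, AEqBind.transl_eq h, AEqArg.transl_eq hs]
theorem AEqBind.transl_eq : {m : ℕ} → {b b' : NomBind S m} → AEqBind b b' →
    b.transl = b'.transl
  | _, _, _, .body h => by simp only [NomBind.transl, AEq.transl_eq h]
  | _, _, _, .bind (x := x) (x' := x') (b := b) (b' := b') hy hy' h => by
      simp only [NomBind.transl]
      rw [← NomBind.cls_transl_rename x b hy, ← NomBind.cls_transl_rename x' b' hy',
        AEqBind.transl_eq h]
end

/-- Soundness of the translation for α-equivalence: M ∼ M' → ⟦M⟧ = ⟦M'⟧. -/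
theorem transl_sound (S : Sig) (M M' : NomTrm S) (h : AEq M M') :
    M.transl = M'.transl := h.transl_eq
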